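/- arXiv:2205.08328 — 4 statements merged into one kernel-verified Lean document; each statement's English description precedes it below -/
import Mathlib

section
/- For all real numbers x > 0, y > 0, x̄ > 0, ȳ > 0, the following inequality holds: log(1 + x/y) ≥ log(1 + x̄/ȳ) + 2x̄/(x̄ + ȳ) − x̄²/((x̄ + ȳ)·x) − (x̄·y)/((x̄ + ȳ)·ȳ). Moreover, equality holds when x = x̄ and y = ȳ. -/
/-- Concavity of `log` between `1` and `t`. -/
lemma mul_log_le_log_convex_comb_one {p t : ℝ} (hp : 0 ≤ p) (hp1 : p ≤ 1) (ht : 0 < t) :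
    p * Real.log t ≤ Real.log (p * t + (1 - p)) := by
  simpa using strictConcaveOn_log_Ioi.concaveOn.2 (Set.mem_Ioi.2 ht)
    (Set.mem_Ioi.2 one_pos) hp (sub_nonneg.2 hp1) (by ring)


/-- Logarithmic lower-bound inequality (eq. (37)): for positive `x, y, x̄, ȳ`,
`log(1 + x/y) ≥ log(1 + x̄/ȳ) + 2x̄/(x̄+ȳ) − x̄²/((x̄+ȳ)x) − x̄·y/((x̄+ȳ)ȳ)`,
with equality when `x = x̄` and `y = ȳ`. -/
theorem log_lower_bound (x y xb yb : ℝ) (hx : 0 < x) (hy : 0 < y)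
    (hxb : 0 < xb) (hyb : 0 < yb) :
    Real.log (1 + x / y) ≥
      Real.log (1 + xb / yb) + 2 * xb / (xb + yb) - xb ^ 2 / ((xb + yb) * x)
        - xb * y / ((xb + yb) * yb)
    ∧ (x = xb → y = yb →
      Real.log (1 + x / y) =
        Real.log (1 + xb / yb) + 2 * xb / (xb + yb) - xb ^ 2 / ((xb + yb) * x)
          - xb * y / ((xb + yb) * yb)) := by
  have hs : 0 < xb + yb := by positivity
  constructor
  · set p := xb / (xb + yb) with hp
    have hp0 : 0 < p := by positivity
    have hp1 : p < 1 := by rw [hp, div_lt_one hs]; linarith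
    have ha : 0 < xb / x := by positivity
    have hb : 0 < y / yb := by positivity
    set t := (xb / x * (y / yb))⁻¹ with ht
    have ht0 : 0 < t := by positivity
    have hfac : 1 + x / y = (1 + xb / yb) * (p * t + (1 - p)) := by
      rw [ht, hp]
      field_simp
      ring
    have hcomb : 0 < p * t + (1 - p) := add_pos (by positivity) (by linarith)
    have hlog : Real.log t = -(Real.log (xb / x) + Real.log (y / yb)) := by
      rw [ht, Real.log_inv, Real.log_mul ha.ne' hb.ne']
    have hlin : p * (2 - xb / x - y / yb) ≤ p * Real.log t := by
      refine mul_le_mul_of_nonneg_left ?_ hp0.le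
      linarith [Real.log_le_sub_one_of_pos ha, Real.log_le_sub_one_of_pos hb]
    have hrhs : 2 * xb / (xb + yb) - xb ^ 2 / ((xb + yb) * x) - xb * y / ((xb + yb) * yb)
        = p * (2 - xb / x - y / yb) := by
      rw [hp]
      field_simp
    rw [hfac, Real.log_mul (by positivity) hcomb.ne']
    linarith [mul_log_le_log_convex_comb_one hp0.le hp1.le ht0]
  · rintro rfl rfl
    field_simp
    ring
end

section
/- For all real numbers x > 0, y > 0, x̄ > 0, ȳ > 0, the following inequality holds: log(1 + x/y) ≤ log(1 + x̄/ȳ) + (ȳ/(x̄ + ȳ)) · ((x² + x̄²)/(2·x̄·y) − x̄/ȳ). Moreover, equality holds when x = x̄ and y = ȳ. -/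
/-- The graph of the logarithm lies below its tangent line at `b`. -/
theorem log_le_log_add_sub_div {a b : ℝ} (ha : 0 < a) (hb : 0 < b) :
    Real.log a ≤ Real.log b + (a - b) / b := by
  have h := Real.log_le_sub_one_of_pos (div_pos ha hb)
  rw [Real.log_div ha.ne' hb.ne'] at h
  rw [sub_div, div_self hb.ne']
  linarith

/-- Logarithmic upper-bound inequality (eq. (48)): for positive `x, y, x̄, ȳ`,
`log(1 + x/y) ≤ log(1 + x̄/ȳ) + (ȳ/(x̄+ȳ))·((x² + x̄²)/(2x̄y) − x̄/ȳ)`,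
with equality when `x = x̄` and `y = ȳ`. -/
theorem log_upper_bound (x y xb yb : ℝ) (hx : 0 < x) (hy : 0 < y)
    (hxb : 0 < xb) (hyb : 0 < yb) :
    Real.log (1 + x / y) ≤
      Real.log (1 + xb / yb) + (yb / (xb + yb)) * ((x ^ 2 + xb ^ 2) / (2 * xb * y) - xb / yb)
    ∧ (x = xb → y = yb →
      Real.log (1 + x / y) =
        Real.log (1 + xb / yb)
          + (yb / (xb + yb)) * ((x ^ 2 + xb ^ 2) / (2 * xb * y) - xb / yb)) := by
  constructor
  · have tangent : Real.log (1 + x / y) ≤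
        Real.log (1 + xb / yb) + yb / (xb + yb) * (x / y - xb / yb) := by
      convert log_le_log_add_sub_div (a := 1 + x / y) (b := 1 + xb / yb)
        (by positivity) (by positivity) using 2
      field_simp
      ring
    have amgm : x / y ≤ (x ^ 2 + xb ^ 2) / (2 * xb * y) := by
      rw [div_le_div_iff₀ hy (by positivity)]
      nlinarith [mul_nonneg hy.le (sq_nonneg (x - xb))]
    refine tangent.trans ?_
    gcongr
  · rintro rfl rfl
    have h : (x ^ 2 + x ^ 2) / (2 * x * y) = x / y := by
      field_simp
      ring
    rw [h, sub_self, mul_zero, add_zero]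
end

section
/- Let L and K be nonempty finite index sets and let ρ_d > 0, B > 0, real numbers τ_c > τ_{d,p} > 0, and natural numbers M with M > |L| + |K| be given. For each ℓ ∈ L let β_ℓ, σ_{d,ℓ} be reals with 0 < σ²_{d,ℓ} ≤ β_ℓ. For power-control vectors η = (η_i)_{i∈L} with η_i ≥ 0 and ζ = (ζ_k)_{k∈K} with ζ_k ≥ 0, define Ψ_{d,ℓ}(η) = ρ_d·(M − |L| − |K|)·σ²_{d,ℓ}·η_ℓ and Θ_{d,ℓ}(η, ζ) = 1 + ρ_d·(β_ℓ − σ²_{d,ℓ})·∑_{i∈L} η_i + ρ_d·β_ℓ·∑_{k∈K} ζ_k, and the rate R_{d,ℓ}(η, ζ) = ((τ_c − τ_{d,p})/τ_c)·B·log₂(1 + Ψ_{d,ℓ}(η)/Θ_{d,ℓ}(η, ζ)). Fix a reference point (η⁽ⁿ⁾, ζ⁽ⁿ⁾) with η⁽ⁿ⁾_ℓ > 0 and all components nonnegative, and write Ψ⁽ⁿ⁾ = Ψ_{d,ℓ}(η⁽ⁿ⁾), Θ⁽ⁿ⁾ = Θ_{d,ℓ}(η⁽ⁿ⁾, ζ⁽ⁿ⁾).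 Then for every (η, ζ) with η_ℓ > 0 and all components nonnegative: ((τ_c − τ_{d,p})/(τ_c·ln 2))·B·[ ln(1 + Ψ⁽ⁿ⁾/Θ⁽ⁿ⁾) + 2Ψ⁽ⁿ⁾/(Ψ⁽ⁿ⁾ + Θ⁽ⁿ⁾) − (Ψ⁽ⁿ⁾)²/((Ψ⁽ⁿ⁾ + Θ⁽ⁿ⁾)·Ψ_{d,ℓ}(η)) − Ψ⁽ⁿ⁾·Θ_{d,ℓ}(η, ζ)/((Ψ⁽ⁿ⁾ + Θ⁽ⁿ⁾)·Θ⁽ⁿ⁾) ] ≤ R_{d,ℓ}(η, ζ). -/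
/-- The logarithm `log (1 + x / y)` is bounded below by a jointly concave function of `(x, y)` that
agrees with it at `(a, b)`. -/
theorem le_log_one_add_div {a b x y : ℝ} (ha : 0 < a) (hb : 0 < b) (hx : 0 < x) (hy : 0 < y) :
    Real.log (1 + a / b) + 2 * a / (a + b) - a ^ 2 / ((a + b) * x) - a * y / ((a + b) * b)
      ≤ Real.log (1 + x / y) := by
  have hab : 0 < a + b := by positivity
  have hu : 0 < x / a := by positivity
  have hv : 0 < y / b := by positivity
  have hconc : a / (a + b) * Real.log (x / a) + b / (a + b) * Real.log (y / b)
      ≤ Real.log (a / (a + b) * (x / a) + b / (a + b) * (y / b)) := by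
    have h := strictConcaveOn_log_Ioi.concaveOn.2 (Set.mem_Ioi.2 hu) (Set.mem_Ioi.2 hv)
      (by positivity : 0 ≤ a / (a + b)) (by positivity : 0 ≤ b / (a + b)) (by field_simp)
    simpa only [smul_eq_mul] using h
  have hmean : a / (a + b) * (x / a) + b / (a + b) * (y / b) = (x + y) / (a + b) := by
    field_simp
  rw [hmean, Real.log_div (by positivity : x + y ≠ 0) hab.ne'] at hconc
  have hlogu : 1 - a / x ≤ Real.log (x / a) := by
    simpa using Real.one_sub_inv_le_log_of_pos hu
  have hlogv : Real.log (y / b) ≤ y / b - 1 := Real.log_le_sub_one_of_pos hv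
  have hbound : a / (a + b) * (2 - a / x - y / b)
      ≤ a / (a + b) * (Real.log (x / a) - Real.log (y / b)) :=
    mul_le_mul_of_nonneg_left (by linarith) (by positivity)
  have hexpand : a / (a + b) * (2 - a / x - y / b)
      = 2 * a / (a + b) - a ^ 2 / ((a + b) * x) - a * y / ((a + b) * b) := by
    field_simp
  have hsplit : b / (a + b) * Real.log (y / b)
      = Real.log (y / b) - a / (a + b) * Real.log (y / b) := by
    field_simp
    ring
  have hyb : Real.log (y / b) = Real.log y - Real.log b := Real.log_div hy.ne' hb.ne'
  have hrate : Real.log (1 + x / y) = Real.log (x + y) - Real.log y := by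
    rw [← Real.log_div (by positivity) hy.ne']
    congr 1
    field_simp
    ring
  have href : Real.log (1 + a / b) = Real.log (a + b) - Real.log b := by
    rw [← Real.log_div (by positivity) hb.ne']
    congr 1
    field_simp
    ring
  linarith


/-- Concave lower bound `R̃_{d,ℓ} ≤ R_{d,ℓ}` (eq. (40a) with the explicit expression
(49a)) for the downlink rate of FL user `ℓ` in Step (S1), obtained by instantiating the
logarithmic lower-bound inequality (eq. (37)) at the SCA iterate `(η⁽ⁿ⁾, ζ⁽ⁿ⁾)`. -/
theorem rate_concave_lower_bound {ι κ : Type*}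
    (L : Finset ι) (K : Finset κ) (hL : L.Nonempty) (hK : K.Nonempty)
    (ρd B τc τdp : ℝ) (M : ℕ)
    (hρd : 0 < ρd) (hB : 0 < B) (hτdp : 0 < τdp) (hτ : τdp < τc)
    (hM : L.card + K.card < M)
    (β σ : ι → ℝ) (hσβ : ∀ i ∈ L, 0 < (σ i) ^ 2 ∧ (σ i) ^ 2 ≤ β i)
    (ℓ : ι) (hℓ : ℓ ∈ L)
    (ηn : ι → ℝ) (ζn : κ → ℝ)
    (hηn : ∀ i ∈ L, 0 ≤ ηn i) (hηnℓ : 0 < ηn ℓ) (hζn : ∀ k ∈ K, 0 ≤ ζn k)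
    (η : ι → ℝ) (ζ : κ → ℝ)
    (hη : ∀ i ∈ L, 0 ≤ η i) (hηℓ : 0 < η ℓ) (hζ : ∀ k ∈ K, 0 ≤ ζ k) :
    let Ψ : (ι → ℝ) → ℝ := fun e => ρd * ((M : ℝ) - L.card - K.card) * (σ ℓ) ^ 2 * e ℓ
    let Θ : (ι → ℝ) → (κ → ℝ) → ℝ := fun e z =>
      1 + ρd * (β ℓ - (σ ℓ) ^ 2) * (∑ i ∈ L, e i) + ρd * β ℓ * (∑ k ∈ K, z k)
    ((τc - τdp) / (τc * Real.log 2)) * B *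
        (Real.log (1 + Ψ ηn / Θ ηn ζn) + 2 * Ψ ηn / (Ψ ηn + Θ ηn ζn)
          - (Ψ ηn) ^ 2 / ((Ψ ηn + Θ ηn ζn) * Ψ η)
          - Ψ ηn * Θ η ζ / ((Ψ ηn + Θ ηn ζn) * Θ ηn ζn))
      ≤ ((τc - τdp) / τc) * B * Real.logb 2 (1 + Ψ η / Θ η ζ) := by
  intro Ψ Θ
  obtain ⟨hσ, hβ⟩ := hσβ ℓ hℓ
  have hM' : 0 < (M : ℝ) - L.card - K.card := by
    have : (L.card : ℝ) + K.card < M := by exact_mod_cast hM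
    linarith
  have hΨ : ∀ e : ι → ℝ, 0 < e ℓ → 0 < Ψ e := fun e he => by
    simp only [Ψ]
    positivity
  have hΘ : ∀ (e : ι → ℝ) (z : κ → ℝ), (∀ i ∈ L, 0 ≤ e i) → (∀ k ∈ K, 0 ≤ z k) →
      0 < Θ e z := fun e z he hz => by
    have hβσ : 0 ≤ β ℓ - σ ℓ ^ 2 := sub_nonneg.2 hβ
    have hβ₀ : 0 ≤ β ℓ := hσ.le.trans hβ
    have hsumL : 0 ≤ ∑ i ∈ L, e i := Finset.sum_nonneg he
    have hsumK : 0 ≤ ∑ k ∈ K, z k := Finset.sum_nonneg hz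
    simp only [Θ]
    positivity
  have hlog2 : 0 < Real.log 2 := Real.log_pos one_lt_two
  have hτc : 0 < τc := hτdp.trans hτ
  have hcoef : 0 ≤ (τc - τdp) / (τc * Real.log 2) * B := by
    have : 0 < τc - τdp := sub_pos.2 hτ
    positivity
  have hrate : (τc - τdp) / τc * B * Real.logb 2 (1 + Ψ η / Θ η ζ)
      = (τc - τdp) / (τc * Real.log 2) * B * Real.log (1 + Ψ η / Θ η ζ) := by
    rw [Real.logb]
    field_simp
  rw [hrate]
  exact mul_le_mul_of_nonneg_left
    (le_log_one_add_div (hΨ ηn hηnℓ) (hΘ ηn ζn hηn hζn) (hΨ η hηℓ) (hΘ η ζ hη hζ)) hcoef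
end

section
/- Let L and K be nonempty finite index sets and let ρ_d > 0, B > 0, real numbers τ_c > τ_{d,p} > 0, and natural numbers M with M > |L| + |K| be given. For each ℓ ∈ L let β_ℓ, σ_{d,ℓ} be reals with 0 < σ²_{d,ℓ} ≤ β_ℓ. For power-control vectors η = (η_i)_{i∈L} with η_i ≥ 0 and ζ = (ζ_k)_{k∈K} with ζ_k ≥ 0, define Ψ_{d,ℓ}(η) = ρ_d·(M − |L| − |K|)·σ²_{d,ℓ}·η_ℓ and Θ_{d,ℓ}(η, ζ) = 1 + ρ_d·(β_ℓ − σ²_{d,ℓ})·∑_{i∈L} η_i + ρ_d·β_ℓ·∑_{k∈K} ζ_k, and the rate R_{d,ℓ}(η, ζ) = ((τ_c − τ_{d,p})/τ_c)·B·log₂(1 + Ψ_{d,ℓ}(η)/Θ_{d,ℓ}(η, ζ)). Fix a reference point (η⁽ⁿ⁾, ζ⁽ⁿ⁾) with η⁽ⁿ⁾_ℓ > 0 and all components nonnegative, and write Ψ⁽ⁿ⁾ = Ψ_{d,ℓ}(η⁽ⁿ⁾), Θ⁽ⁿ⁾ = Θ_{d,ℓ}(η⁽ⁿ⁾, ζ⁽ⁿ⁾).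 Then for every (η, ζ) with η_ℓ > 0 and all components nonnegative: R_{d,ℓ}(η, ζ) ≤ ((τ_c − τ_{d,p})/(τ_c·ln 2))·B·[ ln(1 + Ψ⁽ⁿ⁾/Θ⁽ⁿ⁾) + (Θ⁽ⁿ⁾/(Ψ⁽ⁿ⁾ + Θ⁽ⁿ⁾))·( (Ψ_{d,ℓ}(η)² + (Ψ⁽ⁿ⁾)²)/(2·Ψ⁽ⁿ⁾·Θ_{d,ℓ}(η, ζ)) − Ψ⁽ⁿ⁾/Θ⁽ⁿ⁾ ) ]. -/
/-- The tangent-line bound for `x ↦ log (1 + x)` at `p₀ / t₀`, with the slope written as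
`t₀ / (p₀ + t₀)` and `p` replaced by its upper bound `(p ^ 2 + p₀ ^ 2) / (2 * p₀)`. -/
theorem log_one_add_div_le {p p₀ t t₀ : ℝ} (hp : 0 < p) (hp₀ : 0 < p₀) (ht : 0 < t)
    (ht₀ : 0 < t₀) :
    Real.log (1 + p / t) ≤ Real.log (1 + p₀ / t₀)
      + (t₀ / (p₀ + t₀)) * ((p ^ 2 + p₀ ^ 2) / (2 * p₀ * t) - p₀ / t₀) := by
  have h_tangent : Real.log (1 + p / t) - Real.log (1 + p₀ / t₀)
      ≤ (t₀ / (p₀ + t₀)) * (p / t - p₀ / t₀) := by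
    rw [← Real.log_div (by positivity) (by positivity)]
    refine (Real.log_le_sub_one_of_pos (by positivity)).trans_eq ?_
    field_simp
    ring
  have h_amgm : p / t ≤ (p ^ 2 + p₀ ^ 2) / (2 * p₀ * t) := by
    rw [div_le_div_iff₀ ht (by positivity)]
    nlinarith [mul_nonneg ht.le (sq_nonneg (p - p₀))]
  have h_slope : (t₀ / (p₀ + t₀)) * (p / t - p₀ / t₀)
      ≤ (t₀ / (p₀ + t₀)) * ((p ^ 2 + p₀ ^ 2) / (2 * p₀ * t) - p₀ / t₀) := by
    gcongr
  linarith

/-- Convex upper bound `R_{d,ℓ} ≤ R̂_{d,ℓ}` (constraint (44a) with the explicit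
expression of Appendix C) for the downlink rate of FL user `ℓ` in Step (S1), obtained
by instantiating the logarithmic upper-bound inequality (eq. (48)) at the SCA iterate
`(η⁽ⁿ⁾, ζ⁽ⁿ⁾)`. -/
theorem rate_convex_upper_bound {ι κ : Type*}
    (L : Finset ι) (K : Finset κ) (hL : L.Nonempty) (hK : K.Nonempty)
    (ρd B τc τdp : ℝ) (M : ℕ)
    (hρd : 0 < ρd) (hB : 0 < B) (hτdp : 0 < τdp) (hτ : τdp < τc)
    (hM : L.card + K.card < M)
    (β σ : ι → ℝ) (hσβ : ∀ i ∈ L, 0 < (σ i) ^ 2 ∧ (σ i) ^ 2 ≤ β i)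
    (ℓ : ι) (hℓ : ℓ ∈ L)
    (ηn : ι → ℝ) (ζn : κ → ℝ)
    (hηn : ∀ i ∈ L, 0 ≤ ηn i) (hηnℓ : 0 < ηn ℓ) (hζn : ∀ k ∈ K, 0 ≤ ζn k)
    (η : ι → ℝ) (ζ : κ → ℝ)
    (hη : ∀ i ∈ L, 0 ≤ η i) (hηℓ : 0 < η ℓ) (hζ : ∀ k ∈ K, 0 ≤ ζ k) :
    let Ψ : (ι → ℝ) → ℝ := fun e => ρd * ((M : ℝ) - L.card - K.card) * (σ ℓ) ^ 2 * e ℓ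
    let Θ : (ι → ℝ) → (κ → ℝ) → ℝ := fun e z =>
      1 + ρd * (β ℓ - (σ ℓ) ^ 2) * (∑ i ∈ L, e i) + ρd * β ℓ * (∑ k ∈ K, z k)
    ((τc - τdp) / τc) * B * Real.logb 2 (1 + Ψ η / Θ η ζ)
      ≤ ((τc - τdp) / (τc * Real.log 2)) * B *
          (Real.log (1 + Ψ ηn / Θ ηn ζn)
            + (Θ ηn ζn / (Ψ ηn + Θ ηn ζn)) *
              (((Ψ η) ^ 2 + (Ψ ηn) ^ 2) / (2 * Ψ ηn * Θ η ζ) - Ψ ηn / Θ ηn ζn)) := by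
  intro Ψ Θ
  obtain ⟨hσ, hβ⟩ := hσβ ℓ hℓ
  have hM' : (0 : ℝ) < (M : ℝ) - L.card - K.card := by
    have : (L.card : ℝ) + K.card < M := by exact_mod_cast hM
    linarith
  have hΨ : ∀ e : ι → ℝ, 0 < e ℓ → 0 < Ψ e := fun e he =>
    mul_pos (mul_pos (mul_pos hρd hM') hσ) he
  have hΘ : ∀ (e : ι → ℝ) (z : κ → ℝ), (∀ i ∈ L, 0 ≤ e i) → (∀ k ∈ K, 0 ≤ z k) →
      0 < Θ e z := by
    intro e z he hz
    have h₁ : 0 ≤ ρd * (β ℓ - (σ ℓ) ^ 2) * ∑ i ∈ L, e i :=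
      mul_nonneg (mul_nonneg hρd.le (sub_nonneg.2 hβ)) (Finset.sum_nonneg he)
    have h₂ : 0 ≤ ρd * β ℓ * ∑ k ∈ K, z k :=
      mul_nonneg (mul_nonneg hρd.le (hσ.le.trans hβ)) (Finset.sum_nonneg hz)
    simp only [Θ]
    linarith
  have hτc : 0 < τc := hτdp.trans hτ
  have h_log : 0 < Real.log 2 := Real.log_pos one_lt_two
  have h_rate : ((τc - τdp) / τc) * B * Real.logb 2 (1 + Ψ η / Θ η ζ)
      = ((τc - τdp) / (τc * Real.log 2)) * B * Real.log (1 + Ψ η / Θ η ζ) := by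
    rw [Real.logb]
    field_simp
  rw [h_rate]
  exact mul_le_mul_of_nonneg_left
    (log_one_add_div_le (hΨ η hηℓ) (hΨ ηn hηnℓ) (hΘ η ζ hη hζ) (hΘ ηn ζn hηn hζn))
    (mul_nonneg (div_nonneg (sub_nonneg.2 hτ.le) (mul_pos hτc h_log).le) hB.le)
end
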